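/- Uniqueness of the nearest center with respect to the ρ-scale (claim in the proof of Lemma 5.2): Suppose (d_t)_{t∈I} satisfies condition (RF4) with constant K ≥ 1 and that I is unbounded below. Let ρ' ≥ 4K and set σ = ρ'/(ρ'−K), so that 1 < σ ≤ 4/3. Let C̃ ⊆ M and let r̃ : C̃ → (0,∞) be such that the balls B̃_{ρ'}(z, r̃_z), z ∈ C̃, are mutually disjoint. Suppose x ∈ M and x̃ ∈ C̃ satisfy D_{ρ'}(x, x̃) ≤ r̃_{x̃}/4. Then for every ỹ ∈ C̃ with ỹ ≠ x̃ one has D_{ρ'}(x, ỹ) ≥ (1 − σ/4)·σ^{−1}·r̃_{x̃} ≥ r̃_{x̃}/2 > 0 and D_{ρ'}(x, ỹ) ≥ 2·D_{ρ'}(x, x̃). In particular x̃ is the unique minimizer of D_{ρ'}(x, ·) on C̃. -/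

import Mathlib

open scoped ENNReal

noncomputable section

/-- A family of distance functions `d t x y` on a set `M`, indexed by times `t` in a
set `I ⊆ ℝ` which is a nonempty interval with supremum `0`, such that `d t` is a
metric on `M` for every `t ∈ I`. -/
structure FlowMetric (M : Type*) (I : Set ℝ) where
  d : ℝ → M → M → ℝ
  ordConnected : I.OrdConnected
  nonempty : I.Nonempty
  isLUB_zero : IsLUB I 0
  d_self : ∀ t ∈ I, ∀ x : M, d t x x = 0
  eq_of_d_eq_zero : ∀ t ∈ I, ∀ x y : M, d t x y = 0 → x = y
  d_symm : ∀ t ∈ I, ∀ x y : M, d t x y = d t y x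
  d_triangle : ∀ t ∈ I, ∀ x y z : M, d t x z ≤ d t x y + d t y z

/-- Condition (RF4): the lower distance-distortion estimate with constant `K ≥ 1`:
`d_s(x,y) ≤ d_t(x,y) + K(√|s| − √|t|)` for all `s < t` in `I`. -/
def RF4 {M : Type*} {I : Set ℝ} (fm : FlowMetric M I) (K : ℝ) : Prop :=
  1 ≤ K ∧ ∀ x y : M, ∀ s ∈ I, ∀ t ∈ I, s < t →
    fm.d s x y ≤ fm.d t x y + K * (Real.sqrt |s| - Real.sqrt |t|)

/-- The set `I^ρ_{x,y}` of admissible scales: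
`{r > 0 : −r² ∈ I and d_{−r²}(x,y) < ρ·r}`. -/
def scaleSet {M : Type*} {I : Set ℝ} (fm : FlowMetric M I) (ρ : ℝ) (x y : M) : Set ℝ :=
  {r : ℝ | 0 < r ∧ -r ^ 2 ∈ I ∧ fm.d (-r ^ 2) x y < ρ * r}

/-- The `ρ`-scale `D_ρ(x,y) = inf I^ρ_{x,y} ∈ [0,+∞]`, equal to `+∞` when
`I^ρ_{x,y} = ∅`. -/
def Dscale {M : Type*} {I : Set ℝ} (fm : FlowMetric M I) (ρ : ℝ) (x y : M) : ℝ≥0∞ :=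
  ⨅ r ∈ scaleSet fm ρ x y, ENNReal.ofReal r

/-- The ball `B̃_ρ(x,r) = {y : d_{−r²}(x,y) < ρ·r}`. -/
def tball {M : Type*} {I : Set ℝ} (fm : FlowMetric M I) (ρ : ℝ) (x : M) (r : ℝ) : Set M :=
  {y : M | fm.d (-r ^ 2) x y < ρ * r}

theorem neg_sq_mem_of_not_bddBelow {M : Type*} {I : Set ℝ} (fm : FlowMetric M I)
    (hI : ¬ BddBelow I) {r : ℝ} (hr : 0 < r) : -r ^ 2 ∈ I := by
  obtain ⟨a, ha, har⟩ := not_bddBelow_iff.1 hI (-r ^ 2)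
  obtain ⟨b, hb, hrb, -⟩ := fm.isLUB_zero.exists_between (neg_neg_of_pos (pow_pos hr 2))
  exact fm.ordConnected.out ha hb ⟨har.le, hrb.le⟩

theorem RF4.d_neg_sq_le {M : Type*} {I : Set ℝ} {fm : FlowMetric M I} {K : ℝ}
    (h : RF4 fm K) (x y : M) {r s : ℝ} (hr : 0 < r) (hrs : r ≤ s)
    (hrI : -r ^ 2 ∈ I) (hsI : -s ^ 2 ∈ I) :
    fm.d (-s ^ 2) x y ≤ fm.d (-r ^ 2) x y + K * (s - r) := by
  rcases hrs.eq_or_lt with rfl | hlt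
  · simp
  · have := h.2 x y _ hsI _ hrI (by nlinarith)
    simpa [Real.sqrt_sq hr.le,
      Real.sqrt_sq (hr.le.trans hrs)] using this

/-- The `ρ`-balls about a fixed point grow with the scale. -/
theorem RF4.mem_scaleSet_mono {M : Type*} {I : Set ℝ} {fm : FlowMetric M I} {K ρ : ℝ}
    (h : RF4 fm K) (hI : ¬ BddBelow I) (hKρ : K ≤ ρ) {x y : M} {r s : ℝ}
    (hr : r ∈ scaleSet fm ρ x y) (hrs : r ≤ s) : s ∈ scaleSet fm ρ x y := by
  have hs := hr.1.trans_le hrs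
  have hsI := neg_sq_mem_of_not_bddBelow fm hI hs
  refine ⟨hs, hsI, ?_⟩
  have := h.d_neg_sq_le x y hr.1 hrs hr.2.1 hsI
  nlinarith [hr.2.2, mul_nonneg (sub_nonneg.2 hKρ) (sub_nonneg.2 hrs)]

theorem mem_scaleSet_comm {M : Type*} {I : Set ℝ} {fm : FlowMetric M I} {ρ : ℝ}
    {x y : M} {r : ℝ} : r ∈ scaleSet fm ρ x y ↔ r ∈ scaleSet fm ρ y x := by
  refine and_congr_right fun _ => and_congr_right fun hI => ?_
  rw [fm.d_symm _ hI]

/-- Triangle inequality for admissible scales: the distances are compared at the larger scale `s`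
and then transported to the scale `R`. -/
theorem RF4.mem_scaleSet_of_le {M : Type*} {I : Set ℝ} {fm : FlowMetric M I} {K ρ : ℝ}
    (h : RF4 fm K) (hI : ¬ BddBelow I) {x y z : M} {r s R : ℝ}
    (hr : r ∈ scaleSet fm ρ x y) (hs : s ∈ scaleSet fm ρ y z) (hrs : r ≤ s) (hsR : s ≤ R)
    (hR : (ρ - K) * r + ρ * s ≤ (ρ - K) * R) : R ∈ scaleSet fm ρ x z := by
  have hR0 := hs.1.trans_le hsR
  have hRI := neg_sq_mem_of_not_bddBelow fm hI hR0
  refine ⟨hR0, hRI, ?_⟩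
  have h1 := h.d_neg_sq_le x y hr.1 hrs hr.2.1 hs.2.1
  have h2 := h.d_neg_sq_le x z hs.1 hsR hs.2.1 hRI
  have h3 := fm.d_triangle _ hs.2.1 x y z
  have h4 := hr.2.2
  have h5 := hs.2.2
  linarith

theorem exists_mem_scaleSet_lt {M : Type*} {I : Set ℝ} {fm : FlowMetric M I} {ρ a b : ℝ}
    {x y : M} (h : Dscale fm ρ x y ≤ ENNReal.ofReal a) (hb : 0 < b) (hab : a < b) :
    ∃ r ∈ scaleSet fm ρ x y, r < b := by
  have := h.trans_lt ((ENNReal.ofReal_lt_ofReal_iff hb).2 hab)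
  simp only [Dscale, iInf_lt_iff] at this
  obtain ⟨r, hr, hrb⟩ := this
  exact ⟨r, hr, (ENNReal.ofReal_lt_ofReal_iff hb).1 hrb⟩

/-- **Uniqueness of the nearest center w.r.t. the ρ-scale** (claim in the proof of
Lemma 5.2). Assume (RF4) with constant `K ≥ 1`, `I` unbounded below, `ρ' ≥ 4K`,
and set `σ = ρ'/(ρ'−K)` (so `1 < σ ≤ 4/3`). Let `C̃ ⊆ M` with radii
`r̃_z > 0` such that the balls `B̃_{ρ'}(z, r̃_z)`, `z ∈ C̃`, are mutually disjoint.
If `x ∈ M` and `x̃ ∈ C̃` satisfy `D_{ρ'}(x, x̃) ≤ r̃_{x̃}/4`, then `1 < σ ≤ 4/3`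
and for every `ỹ ∈ C̃` with `ỹ ≠ x̃`:
`D_{ρ'}(x, ỹ) ≥ (1 − σ/4)·σ⁻¹·r̃_{x̃} ≥ r̃_{x̃}/2 > 0`,
`D_{ρ'}(x, ỹ) ≥ 2·D_{ρ'}(x, x̃)`, and `D_{ρ'}(x, x̃) < D_{ρ'}(x, ỹ)`; in
particular `x̃` is the unique minimizer of `D_{ρ'}(x,·)` on `C̃`. -/
theorem unique_nearest_center
    {M : Type*} {I : Set ℝ} (fm : FlowMetric M I) {K : ℝ} (hRF4 : RF4 fm K)
    (hI : ¬ BddBelow I) {ρ' : ℝ} (hρ' : 4 * K ≤ ρ')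
    (C : Set M) (rt : M → ℝ) (hrt : ∀ z ∈ C, 0 < rt z)
    (hdisj : C.Pairwise
      (fun z w => Disjoint (tball fm ρ' z (rt z)) (tball fm ρ' w (rt w))))
    (x xt : M) (hxt : xt ∈ C)
    (hclose : Dscale fm ρ' x xt ≤ ENNReal.ofReal (rt xt / 4)) :
    1 < ρ' / (ρ' - K) ∧ ρ' / (ρ' - K) ≤ 4 / 3 ∧
      ∀ yt ∈ C, yt ≠ xt →
        ENNReal.ofReal ((1 - (ρ' / (ρ' - K)) / 4) * (ρ' / (ρ' - K))⁻¹ * rt xt) ≤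
            Dscale fm ρ' x yt ∧
          ENNReal.ofReal (rt xt / 2) ≤ Dscale fm ρ' x yt ∧
          0 < Dscale fm ρ' x yt ∧
          2 * Dscale fm ρ' x xt ≤ Dscale fm ρ' x yt ∧
          Dscale fm ρ' x xt < Dscale fm ρ' x yt := by
  have hK : 1 ≤ K := hRF4.1
  have ha : 0 < ρ' - K := by linarith
  have hρ : 0 < ρ' := by linarith
  have hKρ : K ≤ ρ' := by linarith
  have hR := hrt xt hxt
  set R := rt xt
  have hσ : 1 < ρ' / (ρ' - K) := by rw [one_lt_div ha]; linarith
  have hσ' : ρ' / (ρ' - K) ≤ 4 / 3 := by rw [div_le_iff₀ ha]; linarith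
  refine ⟨hσ, hσ', fun yt hyt hne => ?_⟩
  have hc : (1 - (ρ' / (ρ' - K)) / 4) * (ρ' / (ρ' - K))⁻¹ * R =
      ((ρ' - K) / ρ' - 1 / 4) * R := by
    field_simp
  have hhalf : R / 2 ≤ ((ρ' - K) / ρ' - 1 / 4) * R := by
    have : 3 / 4 ≤ (ρ' - K) / ρ' := by rw [le_div_iff₀ hρ]; linarith
    nlinarith
  have hmain : ENNReal.ofReal (((ρ' - K) / ρ' - 1 / 4) * R) ≤ Dscale fm ρ' x yt := by
    refine le_iInf₂ fun s hs => ENNReal.ofReal_le_ofReal ?_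
    by_contra! hlt
    have hsR : ρ' * s < (ρ' - K) * R - ρ' * R / 4 := by
      calc ρ' * s < ρ' * (((ρ' - K) / ρ' - 1 / 4) * R) := by gcongr
        _ = _ := by field_simp
    have hb : R / 4 < min (R - ρ' * s / (ρ' - K)) (3 * R / 7) := by
      refine lt_min ?_ (by linarith)
      rw [lt_sub_comm, div_lt_iff₀ ha]
      nlinarith
    obtain ⟨r, hr, hrb⟩ := exists_mem_scaleSet_lt hclose ((by positivity : 0 < R / 4).trans hb) hb
    obtain ⟨hr1, hr2⟩ := lt_min_iff.1 hrb
    have hr3 : (ρ' - K) * r + ρ' * s < (ρ' - K) * R := by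
      rw [lt_sub_comm, div_lt_iff₀ ha] at hr1
      linarith
    have hxR : x ∈ tball fm ρ' xt R :=
      (mem_scaleSet_comm.1 (hRF4.mem_scaleSet_mono hI hKρ hr (by linarith))).2.2
    have hdis := Set.disjoint_left.1 (hdisj hxt hyt hne.symm)
    rcases le_total s (rt yt) with hle | hle
    · exact hdis hxR (mem_scaleSet_comm.1 (hRF4.mem_scaleSet_mono hI hKρ hs hle)).2.2
    · have hy : yt ∈ tball fm ρ' yt (rt yt) := by
        have hpos := hrt yt hyt
        have := fm.d_self _ (neg_sq_mem_of_not_bddBelow fm hI hpos) yt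
        simp only [tball, Set.mem_ofPred_eq, this]
        positivity
      refine hdis ?_ hy
      rcases le_total r s with hrs | hrs
      · refine (hRF4.mem_scaleSet_of_le hI (mem_scaleSet_comm.1 hr) hs hrs ?_ hr3.le).2.2
        have : 0 < K * R := by positivity
        nlinarith
      · refine (mem_scaleSet_comm.1 (hRF4.mem_scaleSet_of_le hI (mem_scaleSet_comm.1 hs) hr hrs
          (by linarith) ?_)).2.2
        have h1 : (ρ' - K) * s ≤ (ρ' - K) * r := by gcongr
        have h2 : ρ' * r ≤ 4 / 3 * (ρ' - K) * r :=
          mul_le_mul_of_nonneg_right (by linarith) hr.1.le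
        have h3 : (ρ' - K) * r ≤ (ρ' - K) * (3 * R / 7) := by gcongr
        linarith
  have hhalf' : ENNReal.ofReal (R / 2) ≤ Dscale fm ρ' x yt :=
    (ENNReal.ofReal_le_ofReal hhalf).trans hmain
  refine ⟨hc ▸ hmain, hhalf', (ENNReal.ofReal_pos.2 (by positivity)).trans_le hhalf', ?_, ?_⟩
  · calc 2 * Dscale fm ρ' x xt ≤ 2 * ENNReal.ofReal (R / 4) := by gcongr
      _ = ENNReal.ofReal (R / 2) := by
        rw [← ENNReal.ofReal_ofNat 2, ← ENNReal.ofReal_mul (by norm_num)]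
        congr 1
        ring
      _ ≤ _ := hhalf'
  · exact hclose.trans_lt
      (((ENNReal.ofReal_lt_ofReal_iff (by positivity)).2 (by linarith)).trans_le hhalf')
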